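/- arXiv:2412.16554 — 4 statements merged into one kernel-verified Lean document; each statement's English description precedes it below -/
import Mathlib

section
/- Let E be a real normed vector space, let M be a subset of E, let x ∈ E, and let x_M ∈ M be a nearest point of x in M, i.e. ‖x - x_M‖ ≤ ‖x - m‖ for every m ∈ M. Then for every λ ∈ [0,1], the point y = λ • x + (1-λ) • x_M satisfies ‖y - x_M‖ ≤ ‖y - m‖ for every m ∈ M; that is, x_M is also a nearest point of y in M. (Existence part of Proposition 1.) -/
/-- Existence part of Proposition 1: if `xM` is a nearest point of `x` in `M`,
then for every `λ ∈ [0,1]`, `xM` is also a nearest point of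
`y = λ • x + (1-λ) • xM` in `M`. -/
theorem stmt_0 {E : Type*} [NormedAddCommGroup E] [NormedSpace ℝ E]
    (M : Set E) (x xM : E) (hxM : xM ∈ M)
    (hnear : ∀ m ∈ M, ‖x - xM‖ ≤ ‖x - m‖)
    (lam : ℝ) (hlam : lam ∈ Set.Icc (0 : ℝ) 1) :
    ∀ m ∈ M, ‖(lam • x + (1 - lam) • xM) - xM‖ ≤ ‖(lam • x + (1 - lam) • xM) - m‖ := by
  intro m hm
  obtain ⟨h0, h1⟩ := hlam
  have e1 : (lam • x + (1 - lam) • xM) - xM = lam • (x - xM) := by module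
  have e2 : x - m = (1 - lam) • (x - xM) + ((lam • x + (1 - lam) • xM) - m) := by module
  have h2 := hnear m hm
  have h3 := norm_add_le ((1 - lam) • (x - xM)) ((lam • x + (1 - lam) • xM) - m)
  rw [← e2, norm_smul, Real.norm_of_nonneg (by linarith)] at h3
  rw [e1, norm_smul, Real.norm_of_nonneg h0]
  linarith
end

section
/- Let E be a real inner product space, let M be a subset of E, let x ∈ E, and let x_M ∈ M be a nearest point of x in M, i.e. ‖x - x_M‖ ≤ ‖x - m‖ for every m ∈ M. Fix λ ∈ [0,1) and set y = λ • x + (1-λ) • x_M. Then x_M is the unique nearest point of y in M: every m ∈ M with ‖y - m‖ ≤ ‖y - x_M‖ satisfies m = x_M. (Uniqueness part of Proposition 1.) -/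
/-- Uniqueness part of Proposition 1: in an inner product space, if `xM` is a nearest
point of `x` in `M` and `λ ∈ [0,1)`, then `xM` is the unique nearest point of
`y = λ • x + (1-λ) • xM` in `M`. -/
theorem stmt_1 {E : Type*} [NormedAddCommGroup E] [InnerProductSpace ℝ E]
    (M : Set E) (x xM : E) (hxM : xM ∈ M)
    (hnear : ∀ m ∈ M, ‖x - xM‖ ≤ ‖x - m‖)
    (lam : ℝ) (hlam : lam ∈ Set.Ico (0 : ℝ) 1) :
    ∀ m ∈ M, ‖(lam • x + (1 - lam) • xM) - m‖ ≤ ‖(lam • x + (1 - lam) • xM) - xM‖ →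
      m = xM := by
  intro m hm h
  obtain ⟨h0, h1⟩ := hlam
  have e1 : x - m = (x - xM) - (m - xM) := by abel
  have e2 : (lam • x + (1 - lam) • xM) - m = lam • (x - xM) - (m - xM) := by module
  have e3 : (lam • x + (1 - lam) • xM) - xM = lam • (x - xM) := by module
  have hn := hnear m hm
  rw [e1] at hn
  rw [e2, e3] at h
  generalize x - xM = u at hn h
  have a := pow_le_pow_left₀ (norm_nonneg _) hn 2
  have b := pow_le_pow_left₀ (norm_nonneg _) h 2
  rw [norm_sub_sq_real] at a b
  rw [real_inner_smul_left] at b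
  have c : ‖m - xM‖ ^ 2 ≤ lam * ‖m - xM‖ ^ 2 := by
    have := mul_le_mul_of_nonneg_left
      (show 2 * inner ℝ u (m - xM) ≤ ‖m - xM‖ ^ 2 by linarith) h0
    linarith
  have d : ‖m - xM‖ ^ 2 = 0 := by
    have := sq_nonneg ‖m - xM‖
    nlinarith
  exact sub_eq_zero.mp (norm_eq_zero.mp (pow_eq_zero_iff two_ne_zero |>.mp d))
end

section
/- Let D, m be positive integers, let Σ be a D × m real matrix with orthonormal columns (Σᵀ Σ = I_m), let α ∈ ℝ^D, and let M be a subset of the affine subspace L = { Σ q + α : q ∈ ℝ^m }. Let A be an m × D real matrix such that the m × m matrix Σᵀ Aᵀ is invertible. Then for every x* ∈ M there exists z ∈ ℝ^m such that x* is the unique nearest point of Aᵀ z in M: ‖Aᵀ z - x*‖ ≤ ‖Aᵀ z - m'‖ for every m' ∈ M, and any m' ∈ M with ‖Aᵀ z - m'‖ = ‖Aᵀ z - x*‖ equals x*. (Deterministic core of Theorem 1.) -/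
open Matrix

/-- Deterministic core of Theorem 1: if `M` is contained in the affine subspace
`L = {Σ q + α : q ∈ ℝ^m}` (where `Σ` has orthonormal columns) and `Σᵀ Aᵀ` is
invertible, then for every `x* ∈ M` there exists `z ∈ ℝ^m` such that `x*` is the
unique nearest point of `Aᵀ z` in `M`. -/
theorem stmt_4 {D m : ℕ} (hD : 0 < D) (hm : 0 < m)
    (Sig : Matrix (Fin D) (Fin m) ℝ) (hSig : Sigᵀ * Sig = 1)
    (α : EuclideanSpace ℝ (Fin D)) (M : Set (EuclideanSpace ℝ (Fin D)))
    (hM : M ⊆ {x | ∃ q : EuclideanSpace ℝ (Fin m), x = Matrix.toEuclideanLin Sig q + α})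
    (A : Matrix (Fin m) (Fin D) ℝ) (hA : IsUnit (Sigᵀ * Aᵀ))
    (xs : EuclideanSpace ℝ (Fin D)) (hxs : xs ∈ M) :
    ∃ z : EuclideanSpace ℝ (Fin m),
      (∀ m' ∈ M, ‖Matrix.toEuclideanLin Aᵀ z - xs‖ ≤ ‖Matrix.toEuclideanLin Aᵀ z - m'‖) ∧
      (∀ m' ∈ M, ‖Matrix.toEuclideanLin Aᵀ z - m'‖ = ‖Matrix.toEuclideanLin Aᵀ z - xs‖ →
        m' = xs) := by
  obtain ⟨B, hB⟩ := hA.exists_right_inv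
  refine ⟨WithLp.toLp 2 (B *ᵥ (Sigᵀ *ᵥ xs.ofLp)), ?_⟩
  set w := Matrix.toEuclideanLin Aᵀ (WithLp.toLp 2 (B *ᵥ (Sigᵀ *ᵥ xs.ofLp))) with hw
  have h0 : Sigᵀ *ᵥ (w - xs).ofLp = 0 := by
    have h1 : w.ofLp = Aᵀ *ᵥ (B *ᵥ (Sigᵀ *ᵥ xs.ofLp)) := rfl
    rw [WithLp.ofLp_sub, Matrix.mulVec_sub, h1, Matrix.mulVec_mulVec, Matrix.mulVec_mulVec,
      hB, Matrix.one_mulVec, sub_self]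
  have key : ∀ m' ∈ M, ‖w - m'‖ ^ 2 = ‖w - xs‖ ^ 2 + ‖xs - m'‖ ^ 2 := by
    intro m' hm'
    obtain ⟨q, hq⟩ := hM hm'
    obtain ⟨p, hp⟩ := hM hxs
    have hd : (xs - m').ofLp = Sig *ᵥ (p - q).ofLp := by
      have : xs - m' = Matrix.toEuclideanLin Sig (p - q) := by
        rw [hp, hq, map_sub]; abel
      rw [this]; rfl
    have hi : inner ℝ (w - xs) (xs - m') = 0 := by
      rw [EuclideanSpace.inner_eq_star_dotProduct, hd, star_trivial, dotProduct_comm,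
        Matrix.dotProduct_mulVec, ← Matrix.mulVec_transpose, h0, zero_dotProduct]
    have h2 : w - m' = (w - xs) + (xs - m') := by abel
    rw [h2, @norm_add_sq_real, hi]; ring
  constructor
  · intro m' hm'
    have := key m' hm'
    exact (sq_le_sq₀ (norm_nonneg _) (norm_nonneg _)).mp (by nlinarith [sq_nonneg ‖xs - m'‖])
  · intro m' hm' he
    have h3 := key m' hm'
    rw [he] at h3
    have h4 : ‖xs - m'‖ ^ 2 = 0 := by linarith
    have h5 : xs - m' = 0 := by simpa using h4
    exact (sub_eq_zero.mp h5).symm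
end

section
/- Let B be a D × (d+1) real matrix with orthonormal columns (Bᵀ B = I_{d+1}), let r > 0 be a real number, and let c ∈ ℝ^{d+1}. For x ∈ ℝ^D with Bᵀ x ≠ c define h(x) = (r / ‖B (Bᵀ x - c)‖) • B (Bᵀ x - c) + B c. Then for every λ ∈ [0,1] and every x with Bᵀ x ≠ c, the point y = λ • x + (1-λ) • h(x) satisfies Bᵀ y ≠ c and h(y) = h(x). In particular the unsupervised consistency loss L_us vanishes identically for the geometry-aware spherical representation h. -/
open Matrix

/-- For the geometry-aware spherical representation
`h(x) = (r / ‖B (Bᵀ x - c)‖) • B (Bᵀ x - c) + B c` (defined when `Bᵀ x ≠ c`),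
for every `λ ∈ [0,1]` the point `y = λ • x + (1-λ) • h(x)` satisfies `Bᵀ y ≠ c` and
`h(y) = h(x)`; hence the unsupervised consistency loss vanishes identically. -/
theorem stmt_9 {D d : ℕ} (B : Matrix (Fin D) (Fin (d + 1)) ℝ) (hB : Bᵀ * B = 1)
    (r : ℝ) (hr : 0 < r) (c : EuclideanSpace ℝ (Fin (d + 1)))
    (h : EuclideanSpace ℝ (Fin D) → EuclideanSpace ℝ (Fin D))
    (hh : ∀ x : EuclideanSpace ℝ (Fin D), Matrix.toEuclideanLin Bᵀ x ≠ c →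
      h x = (r / ‖Matrix.toEuclideanLin B (Matrix.toEuclideanLin Bᵀ x - c)‖) •
        Matrix.toEuclideanLin B (Matrix.toEuclideanLin Bᵀ x - c) + Matrix.toEuclideanLin B c)
    (lam : ℝ) (hlam : lam ∈ Set.Icc (0 : ℝ) 1)
    (x : EuclideanSpace ℝ (Fin D)) (hx : Matrix.toEuclideanLin Bᵀ x ≠ c) :
    Matrix.toEuclideanLin Bᵀ (lam • x + (1 - lam) • h x) ≠ c ∧
      h (lam • x + (1 - lam) • h x) = h x := by
  have hBB : ∀ w : EuclideanSpace ℝ (Fin (d + 1)),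
      Matrix.toEuclideanLin Bᵀ (Matrix.toEuclideanLin B w) = w := by
    intro w
    simp [Matrix.toLpLin_apply, Matrix.mulVec_mulVec, hB]
  obtain ⟨h0, h1⟩ := hlam
  have hu : Matrix.toEuclideanLin Bᵀ x - c ≠ 0 := sub_ne_zero.mpr hx
  have hhx := hh x hx
  generalize hudef : Matrix.toEuclideanLin Bᵀ x - c = u at hu hhx
  have hxu : Matrix.toEuclideanLin Bᵀ x = u + c := by rw [← hudef]; abel
  have hv : Matrix.toEuclideanLin B u ≠ 0 := by
    intro hv
    apply hu
    rw [← hBB u, hv, map_zero]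
  have hn : 0 < ‖Matrix.toEuclideanLin B u‖ := norm_pos_iff.mpr hv
  have hk : 0 < r / ‖Matrix.toEuclideanLin B u‖ := div_pos hr hn
  obtain ⟨t, ht⟩ : ∃ t, t = lam + (1 - lam) * (r / ‖Matrix.toEuclideanLin B u‖) := ⟨_, rfl⟩
  have htpos : 0 < t := by
    rw [ht]
    rcases h0.eq_or_lt with h | h
    · rw [← h]; simpa using hk
    · have := mul_nonneg (sub_nonneg.mpr h1) hk.le
      linarith
  have hy : Matrix.toEuclideanLin Bᵀ (lam • x + (1 - lam) • h x) - c = t • u := by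
    rw [hhx, map_add, map_smul, map_smul, map_add, map_smul, hBB, hBB, hxu, ht]
    module
  have hyc : Matrix.toEuclideanLin Bᵀ (lam • x + (1 - lam) • h x) ≠ c := by
    rw [← sub_ne_zero, hy]
    exact smul_ne_zero htpos.ne' hu
  refine ⟨hyc, ?_⟩
  rw [hh _ hyc, hy, hhx, map_smul, norm_smul, Real.norm_of_nonneg htpos.le, smul_smul]
  congr 2
  field_simp
end
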